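/- Let p be an odd prime, e ≥ 1, n = p^e, 1 ≤ f ≤ e. If φ is an automorphism of G_f = ⟨g, h | g^n = h^n = 1, g⁻¹hg = h^(1+p^f)⟩ with φ(g) = g^i (for some integer i) and φ(gh) = (gh)^j (for some integer j), then i ≡ 1 (mod p^(e-f)) and j ≡ 1 (mod p^(e-f)). -/

import Mathlib

/-- The relations for the group `G_f = ⟨g, h | g^n = h^n = 1, g⁻¹hg = h^q⟩`. -/
def fermatRels (n q : ℕ) : Set (FreeGroup (Fin 2)) :=
  {FreeGroup.of 0 ^ n, FreeGroup.of 1 ^ n,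
   (FreeGroup.of 0)⁻¹ * FreeGroup.of 1 * FreeGroup.of 0 * (FreeGroup.of 1 ^ q)⁻¹}

/-- The group `G_f` (with `n = p^e`, `q = 1 + p^f`). -/
abbrev Gf (n q : ℕ) := PresentedGroup (fermatRels n q)

/-- The generator `g` of `G_f`. -/
def gGen (n q : ℕ) : Gf n q := PresentedGroup.of 0

/-- The generator `h` of `G_f`. -/
def hGen (n q : ℕ) : Gf n q := PresentedGroup.of 1


theorem aux_lte (p e f : ℕ) (hp : p.Prime) (hodd : Odd p) (hf1 : 1 ≤ f) (hfe : f ≤ e) (k : ℕ) :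
    ((p : ℤ) ^ e ∣ ((1 + p ^ f : ℕ) : ℤ) ^ k - 1) ↔ p ^ (e - f) ∣ k := by
  have hpz : Prime (p : ℤ) := Nat.prime_iff_prime_int.mp hp
  have h1 : (p : ℤ) ∣ ((1 + p ^ f : ℕ) : ℤ) - 1 := by
    push_cast
    simpa using dvd_pow_self (p : ℤ) (by omega : f ≠ 0)
  have h2 : ¬ (p : ℤ) ∣ ((1 + p ^ f : ℕ) : ℤ) := by
    intro h
    have := dvd_sub h h1
    simp only [sub_sub_cancel] at this
    exact hpz.not_dvd_one this
  have h := Int.emultiplicity_pow_sub_pow hp hodd h1 h2 k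
  rw [one_pow] at h
  have h3 : emultiplicity (p : ℤ) (((1 + p ^ f : ℕ) : ℤ) - 1) = f := by
    have : (((1 + p ^ f : ℕ) : ℤ) - 1) = (p : ℤ) ^ f := by push_cast; ring
    rw [this]
    exact emultiplicity_pow_self hpz.ne_zero hpz.not_isUnit f
  rw [pow_dvd_iff_le_emultiplicity, pow_dvd_iff_le_emultiplicity, h, h3]
  constructor
  · intro h
    rcases eq_or_ne (emultiplicity p k) ⊤ with ht | ht
    · rw [ht]; exact le_top
    · lift emultiplicity p k to ℕ using ht with m
      norm_cast at h ⊢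
      omega
  · intro h
    calc ((e : ℕ) : ℕ∞) = (f : ℕ∞) + ((e - f : ℕ) : ℕ∞) := by norm_cast; omega
      _ ≤ _ := by gcongr

theorem g_pow (n q : ℕ) : gGen n q ^ n = 1 := by
  have := PresentedGroup.one_of_mem (rels := fermatRels n q) (x := FreeGroup.of 0 ^ n)
    (by simp [fermatRels])
  exact this

theorem h_pow (n q : ℕ) : hGen n q ^ n = 1 := by
  have := PresentedGroup.one_of_mem (rels := fermatRels n q) (x := FreeGroup.of 1 ^ n)
    (by simp [fermatRels])
  exact this

theorem gh_rel (n q : ℕ) : (gGen n q)⁻¹ * hGen n q * gGen n q = hGen n q ^ q := by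
  have := PresentedGroup.one_of_mem (rels := fermatRels n q)
    (x := (FreeGroup.of 0)⁻¹ * FreeGroup.of 1 * FreeGroup.of 0 * (FreeGroup.of 1 ^ q)⁻¹)
    (by simp [fermatRels])
  exact mul_inv_eq_one.mp this

theorem lift_exists (n q : ℕ) {G : Type*} [Group G] (a b : G) (ha : a ^ n = 1) (hb : b ^ n = 1)
    (hab : a⁻¹ * b * a = b ^ q) : ∃ F : Gf n q →* G, F (gGen n q) = a ∧ F (hGen n q) = b := by
  have H : ∀ r ∈ fermatRels n q, FreeGroup.lift ![a, b] r = 1 := by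
    intro r hr
    rcases hr with rfl | rfl | rfl
    · simp [ha]
    · simp [hb]
    · simp [hab]
  exact ⟨PresentedGroup.toGroup H, by simp [gGen], by simp [hGen]⟩

theorem g_hom (n q : ℕ) : ∃ F : Gf n q →* Multiplicative (ZMod n),
    F (gGen n q) = Multiplicative.ofAdd 1 ∧ F (hGen n q) = 1 := by
  apply lift_exists
  · rw [← ofAdd_nsmul]; simp
  · simp
  · simp

theorem h_order (n q : ℕ) (hq : (q : ZMod n) ^ n = 1) (hn : n ≠ 0) (m : ℤ)
    (hm : hGen n q ^ m = 1) : (n : ℤ) ∣ m := by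
  obtain ⟨u, hu⟩ : ∃ u : (ZMod n)ˣ, (u : ZMod n) = q :=
    ⟨Units.ofPowEqOne _ n hq hn, rfl⟩
  have hun : u ^ n = 1 := by ext; simp [hu, hq]
  have key : ∀ k : ℕ, (Equiv.addRight (1 : ZMod n)) ^ k = Equiv.addRight (k : ZMod n) := by
    intro k; simp
  obtain ⟨F, -, hF⟩ := lift_exists n q (G := Equiv.Perm (ZMod n))
    (MulAction.toPermHom (ZMod n)ˣ (ZMod n) u⁻¹) (Equiv.addRight 1)
    (by rw [← map_pow, inv_pow, hun, inv_one, map_one]) (by rw [key]; ext; simp)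
    (by
      rw [key, ← map_inv]
      ext x
      simp [Units.smul_def, hu, ← mul_assoc]
      simp [← hu])
  have := congrArg F hm
  rw [map_zpow, hF, map_one] at this
  have := Equiv.congr_fun this 0
  simp at this
  exact (ZMod.intCast_zmod_eq_zero_iff_dvd m n).mp this

theorem hg_conj_pow (n q : ℕ) (m : ℤ) (k : ℕ) :
    hGen n q ^ m * gGen n q ^ k = gGen n q ^ k * hGen n q ^ (m * (q : ℤ) ^ k) := by
  induction k generalizing m with
  | zero => simp
  | succ k ih =>
    have h1 : ∀ m : ℤ, hGen n q ^ m * gGen n q = gGen n q * hGen n q ^ (m * q) := by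
      intro m
      have := congrArg (· ^ m) (gh_rel n q)
      have h2 : ((gGen n q)⁻¹ * hGen n q * gGen n q) ^ m
          = (gGen n q)⁻¹ * hGen n q ^ m * gGen n q := by
        have := conj_zpow (a := (gGen n q)⁻¹) (b := hGen n q) (i := m)
        simpa using this
      simp only [h2] at this
      rw [mul_comm m, zpow_mul, zpow_natCast, ← this]
      group
    rw [pow_succ, ← mul_assoc, ih, mul_assoc, h1, mul_assoc, ← mul_assoc, ← pow_succ, ← pow_succ]

theorem exists_nat_rep (n : ℕ) (hn : n ≠ 0) (i : ℤ) :
    ∃ k : ℕ, 1 ≤ k ∧ ∃ t : ℤ, (k : ℤ) = i + n * t := by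
  have hn' : (n : ℤ) ≠ 0 := by exact_mod_cast hn
  refine ⟨(i % n + n).toNat, ?_, 1 - i / n, ?_⟩
  · have := Int.emod_nonneg i hn'
    omega
  · have := Int.emod_nonneg i hn'
    have h2 := Int.emod_add_mul_ediv i n
    rw [Int.toNat_of_nonneg (by omega)]
    linarith

theorem g_rep (n q : ℕ) (k : ℕ) (i t : ℤ) (h : (k : ℤ) = i + n * t) :
    gGen n q ^ i = gGen n q ^ k := by
  rw [← zpow_natCast, h, zpow_add, zpow_mul, zpow_natCast, g_pow]; simp

theorem conj_zpow' (n q : ℕ) (hn : n ≠ 0) (m a : ℤ) :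
    ∃ s : ℤ, hGen n q ^ m * gGen n q ^ a = gGen n q ^ a * hGen n q ^ s := by
  obtain ⟨k, -, t, hk⟩ := exists_nat_rep n hn a
  rw [g_rep n q k a t hk, hg_conj_pow]
  exact ⟨_, rfl⟩

theorem gh_zpow (n q : ℕ) (hn : n ≠ 0) (j : ℤ) :
    ∃ s : ℤ, (gGen n q * hGen n q) ^ j = gGen n q ^ j * hGen n q ^ s := by
  induction j using Int.induction_on with
  | zero => exact ⟨0, by simp⟩
  | succ j ih =>
    obtain ⟨s, hs⟩ := ih
    obtain ⟨t, ht⟩ := conj_zpow' n q hn s 1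
    refine ⟨t + 1, ?_⟩
    rw [zpow_one] at ht
    rw [zpow_add_one, hs, zpow_add_one, zpow_add_one, mul_assoc, ← mul_assoc (hGen n q ^ s), ht]
    simp only [mul_assoc]
  | pred j ih =>
    obtain ⟨s, hs⟩ := ih
    obtain ⟨t, ht⟩ := conj_zpow' n q hn (s - 1) (-1)
    refine ⟨t, ?_⟩
    rw [zpow_sub_one, zpow_neg_one, zpow_sub_one] at *
    rw [hs, mul_inv_rev, mul_assoc, ← mul_assoc (hGen n q ^ s), ht]
    simp only [mul_assoc]

theorem stmt10 (p e f : ℕ) (hp : p.Prime) (hodd : Odd p) (he : 1 ≤ e)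
    (hf1 : 1 ≤ f) (hfe : f ≤ e) (n : ℕ) (hn : n = p ^ e) (q : ℕ) (hq : q = 1 + p ^ f)
    (φ : Gf n q ≃* Gf n q) (i j : ℤ)
    (hgi : φ (gGen n q) = gGen n q ^ i)
    (hghj : φ (gGen n q * hGen n q) = (gGen n q * hGen n q) ^ j) :
    i ≡ 1 [ZMOD ((p : ℤ) ^ (e - f))] ∧ j ≡ 1 [ZMOD ((p : ℤ) ^ (e - f))] := by
  have hpz : Prime (p : ℤ) := Nat.prime_iff_prime_int.mp hp
  have hn0 : n ≠ 0 := by rw [hn]; exact pow_ne_zero _ hp.ne_zero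
  have hnz : (n : ℤ) = (p : ℤ) ^ e := by rw [hn]; push_cast; rfl
  rcases hfe.eq_or_lt with rfl | hlt
  · simp [Int.modEq_one]
  have lte := fun k => aux_lte p e f hp hodd hf1 hfe k
  rw [← hq, ← hnz] at lte
  have hdn : p ^ (e - f) ∣ n := by rw [hn]; exact pow_dvd_pow _ (by omega)
  have hqn : (q : ZMod n) ^ n = 1 := by
    have h := (lte n).mpr hdn
    have := (ZMod.intCast_zmod_eq_zero_iff_dvd _ n).mpr h
    push_cast at this
    exact sub_eq_zero.mp this
  have hord := h_order n q hqn hn0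
  -- shape of the image of h
  obtain ⟨s, hs⟩ := gh_zpow n q hn0 j
  have hφh : φ (hGen n q) = gGen n q ^ (j - i) * hGen n q ^ s := by
    rw [map_mul, hgi, hs] at hghj
    rw [eq_inv_mul_of_mul_eq hghj, ← mul_assoc, ← zpow_neg, ← zpow_add]
    congr 2; ring
  have hrel : φ (hGen n q) * φ (gGen n q) = φ (gGen n q) * φ (hGen n q) ^ q := by
    rw [← map_pow, ← gh_rel, ← map_mul, ← map_mul]
    congr 1; group
  -- divisibility of c
  have hc : (p : ℤ) ^ (e - f) ∣ j - i := by
    obtain ⟨F, hFg, hFh⟩ := g_hom n q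
    have h := congrArg F hrel
    rw [hφh, hgi] at h
    simp only [map_mul, map_pow, map_zpow, hFg, hFh, one_zpow, mul_one] at h
    rw [mul_comm] at h
    have h := mul_left_cancel h
    have h := congrArg Multiplicative.toAdd h
    simp only [toAdd_zpow, toAdd_pow, toAdd_ofAdd, zsmul_eq_mul, nsmul_eq_mul, mul_one] at h
    have h3 : ((p ^ f * (j - i) : ℤ) : ZMod n) = 0 := by
      rw [hq] at h
      push_cast at h ⊢
      linear_combination -h
    rw [ZMod.intCast_zmod_eq_zero_iff_dvd, hnz] at h3
    have : (p : ℤ) ^ e = p ^ f * p ^ (e - f) := by rw [← pow_add]; congr 1; omega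
    rw [this] at h3
    exact (mul_dvd_mul_iff_left (pow_ne_zero _ hpz.ne_zero)).mp h3
  -- natural representative of c
  obtain ⟨c, -, t, hct⟩ := exists_nat_rep n hn0 (j - i)
  have hcd : p ^ (e - f) ∣ c := by
    have : ((p ^ (e - f) : ℕ) : ℤ) ∣ (c : ℤ) := by
      rw [hct]
      refine dvd_add (by exact_mod_cast hc) (Dvd.dvd.mul_right ?_ _)
      exact_mod_cast hdn
    exact_mod_cast this
  rw [g_rep n q c _ t hct] at hφh
  have hnpow : ∀ a b : ℤ, (n : ℤ) ∣ a - b → hGen n q ^ a = hGen n q ^ b := by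
    rintro a b ⟨r, hr⟩
    have : a = b + n * r := by linarith
    rw [this, zpow_add, zpow_mul, zpow_natCast, h_pow]; simp
  have hcomm : Commute (gGen n q ^ c) (hGen n q ^ s) := by
    have := hg_conj_pow n q s c
    rw [hnpow (s * (q : ℤ) ^ c) s ?_] at this
    · exact this.symm
    · have h := Dvd.dvd.mul_left ((lte c).mpr hcd) s
      rwa [mul_sub, mul_one] at h
  have hgc : ∀ m : ℕ, p ^ f ∣ m → gGen n q ^ (c * m) = 1 := by
    intro m hm
    have : n ∣ c * m := by
      have h := mul_dvd_mul hcd hm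
      rwa [← pow_add, Nat.sub_add_cancel hfe, ← hn] at h
    obtain ⟨r, hr⟩ := this
    rw [hr, pow_mul, g_pow, one_pow]
  -- s is prime to p
  have hsp : ¬ (p : ℤ) ∣ s := by
    rintro ⟨r, hr⟩
    have h1 : φ (hGen n q ^ (p ^ (e - 1))) = 1 := by
      rw [map_pow, hφh, hcomm.mul_pow, ← pow_mul, hgc _ (pow_dvd_pow _ (by omega)), one_mul,
        ← zpow_natCast, ← zpow_mul, hnpow _ 0 ?_, zpow_zero]
      rw [sub_zero, hnz, hr]
      refine ⟨r, ?_⟩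
      have : (p : ℤ) ^ e = p * p ^ (e - 1) := by rw [← pow_succ']; congr 1; omega
      rw [this]; push_cast; ring
    rw [EmbeddingLike.map_eq_one_iff, ← zpow_natCast] at h1
    have h2 := hord _ h1
    have h2 : n ∣ p ^ (e - 1) := by exact_mod_cast h2
    rw [hn, Nat.pow_dvd_pow_iff_le_right hp.one_lt] at h2
    omega
  -- main relation
  obtain ⟨k, hk1, t', hk⟩ := exists_nat_rep n hn0 i
  rw [g_rep n q k i t' hk] at hgi
  have hmain : hGen n q ^ (s * (q : ℤ) ^ k) = hGen n q ^ (s * (q : ℤ)) := by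
    rw [hgi, hφh, mul_assoc, hg_conj_pow, hcomm.mul_pow, ← pow_mul] at hrel
    have h1 : gGen n q ^ (c * q) = gGen n q ^ c := by
      have h2 : c * q = c + c * p ^ f := by rw [hq]; ring
      rw [h2, pow_add, hgc _ dvd_rfl, mul_one]
    rw [h1, ← mul_assoc, ← mul_assoc, ← pow_add, ← pow_add, add_comm c k] at hrel
    have h := mul_left_cancel hrel
    rw [h, zpow_mul, zpow_natCast]
  have hdvd : (n : ℤ) ∣ s * (q : ℤ) ^ k - s * q := by
    apply hord
    rw [zpow_sub, hmain, mul_inv_cancel]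
  have hqp : ¬ (p : ℤ) ∣ q := by
    intro h
    have h0 : (p : ℤ) ∣ (p : ℤ) ^ f := dvd_pow_self _ (by omega)
    have h2 := dvd_sub h h0
    rw [hq] at h2
    push_cast at h2
    simp only [add_sub_cancel_right] at h2
    exact hpz.not_dvd_one h2
  have hik : p ^ (e - f) ∣ k - 1 := by
    rw [← lte]
    have : s * (q : ℤ) ^ k - s * q = (s * q) * ((q : ℤ) ^ (k - 1) - 1) := by
      obtain ⟨k, rfl⟩ := Nat.exists_eq_add_of_le' hk1
      simp only [Nat.add_sub_cancel, pow_succ]; ring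
    rw [this, hnz] at hdvd
    rw [hnz]
    refine hpz.pow_dvd_of_dvd_mul_left e ?_ hdvd
    intro h
    exact (hpz.dvd_or_dvd h).elim hsp hqp
  have hi : (p : ℤ) ^ (e - f) ∣ i - 1 := by
    have h1 : ((p ^ (e - f) : ℕ) : ℤ) ∣ ((k - 1 : ℕ) : ℤ) := by exact_mod_cast hik
    rw [Nat.cast_sub hk1] at h1
    push_cast at h1
    have h2 : (p : ℤ) ^ (e - f) ∣ n * t' := Dvd.dvd.mul_right (by exact_mod_cast hdn) _
    have := dvd_sub h1 h2
    have h3 : (k : ℤ) - 1 - n * t' = i - 1 := by linarith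
    rwa [h3] at this
  refine ⟨(Int.modEq_iff_dvd.mpr hi).symm, (Int.modEq_iff_dvd.mpr ?_).symm⟩
  have := dvd_add hc hi
  simpa using this
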